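/- arXiv:2501.10302 — 3 statements merged into one kernel-verified Lean document; each statement's English description precedes it below -/
import Mathlib

section
/- Let {X_n}_{n≥1} be a two-state correlated random walk on {1,-1} with parameters 0<p,q<1, started from the stationary distribution, and let S_n = X_1+···+X_n. Then the process M_n = (2-p-q)·S_{n-1} + X_n - (p-q)·(n-1) (with the convention S_0 = 0, so M_1 = X_1) is a martingale with respect to the filtration F_n = σ(X_1,...,X_n). -/
open MeasureTheory ProbabilityTheory Set

noncomputable section

variable {Ω : Type*} [MeasurableSpace Ω]

/-- The σ-algebra `σ(X_1, …, X_n)` generated by the first `n` steps of the process. -/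
def sigmaUpTo (X : ℕ → Ω → ℝ) (n : ℕ) : MeasurableSpace Ω :=
  ⨆ i ∈ Finset.Icc 1 n, MeasurableSpace.comap (X i) inferInstance

/-- The transition kernel of a two-state correlated random walk on `{1, -1}`:
from state `1` go to `1` with probability `p`; from state `-1` go to `-1`
with probability `q`. -/
def crwKernel (p q : ℝ) (i j : ℝ) : ℝ :=
  if i = 1 then (if j = 1 then p else 1 - p)
  else (if j = -1 then q else 1 - q)

/-- `X` is a two-state correlated random walk on `{1, -1}` with parameters `p, q`,
started from the stationary distribution `((1-q)/(2-p-q), (1-p)/(2-p-q))`: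
each `X n` (for `n ≥ 1`) is measurable with values in `{1, -1}`, the initial
distribution is stationary, and the Markov property with the prescribed
time-homogeneous transition probabilities holds, conditionally on
`F n = σ(X_1, …, X_n)`. -/
def IsCRW (μ : Measure Ω) (X : ℕ → Ω → ℝ) (p q : ℝ) : Prop :=
  (∀ i, 1 ≤ i → Measurable (X i)) ∧
  (∀ n, 1 ≤ n → ∀ ω, X n ω = 1 ∨ X n ω = -1) ∧
  (μ {ω | X 1 ω = 1} = ENNReal.ofReal ((1 - q) / (2 - p - q))) ∧
  (∀ n, 1 ≤ n → ∀ i ∈ ({1, -1} : Set ℝ), ∀ j ∈ ({1, -1} : Set ℝ),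
    ∀ E : Set Ω, MeasurableSet[sigmaUpTo X n] E →
      μ (E ∩ {ω | X n ω = i ∧ X (n + 1) ω = j})
        = ENNReal.ofReal (crwKernel p q i j) * μ (E ∩ {ω | X n ω = i}))

/-- The natural filtration `F_{k+1} = σ(X_1, …, X_{k+1})`, shifted so that the
index `k : ℕ` corresponds to time `k + 1` (processes in the paper start at time 1). -/
def crwFiltration (X : ℕ → Ω → ℝ) (hX : ∀ i, 1 ≤ i → Measurable (X i)) :
    Filtration ℕ (inferInstance : MeasurableSpace Ω) where
  seq k := sigmaUpTo X (k + 1)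
  mono' a b hab := by
    refine biSup_mono fun i hi => ?_
    simp only [Finset.mem_Icc] at *
    omega
  le' k := iSup₂_le fun i hi => (hX i (Finset.mem_Icc.mp hi).1).comap_le

theorem measurable_sigmaUpTo {α : Type*} {X : ℕ → α → ℝ} {i n : ℕ} (hi : 1 ≤ i) (hin : i ≤ n) :
    Measurable[sigmaUpTo X n] (X i) := by
  rw [measurable_iff_comap_le]
  exact le_iSup₂_of_le i (Finset.mem_Icc.mpr ⟨hi, hin⟩) le_rfl

namespace IsCRW

variable {μ : Measure Ω} {X : ℕ → Ω → ℝ} {p q : ℝ}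

theorem integrable [IsFiniteMeasure μ] (hX : IsCRW μ X p q) {n : ℕ} (hn : 1 ≤ n) :
    Integrable (X n) μ := by
  refine Integrable.of_bound (hX.1 n hn).aestronglyMeasurable 1 (ae_of_all _ fun ω => ?_)
  rcases hX.2.1 n hn ω with h | h <;> simp [h]

/-- The increment `X (n + 1)`, centred by its one-step prediction, integrates to zero over every
event of `σ(X_1, …, X_n)`. -/
theorem setIntegral_centred_step_eq_zero [IsFiniteMeasure μ] (hp0 : 0 ≤ p) (hp1 : p ≤ 1)
    (hq0 : 0 ≤ q) (hq1 : q ≤ 1) (hX : IsCRW μ X p q) {n : ℕ} (hn : 1 ≤ n) {E : Set Ω}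
    (hE : MeasurableSet[sigmaUpTo X n] E) :
    ∫ ω in E, (X (n + 1) ω - (p - q) - (p + q - 1) * X n ω) ∂μ = 0 := by
  let A (i j : ℝ) : Set Ω := {ω | X n ω = i ∧ X (n + 1) ω = j}
  have hA (i j : ℝ) : MeasurableSet (A i j) :=
    (hX.1 n hn (measurableSet_singleton i)).inter
      (hX.1 (n + 1) (by omega) (measurableSet_singleton j))
  have hdecomp (ω : Ω) : X (n + 1) ω - (p - q) - (p + q - 1) * X n ω =
      ((A 1 1).indicator (fun _ => 2 - 2 * p) ω + (A 1 (-1)).indicator (fun _ => -2 * p) ω) +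
      ((A (-1) 1).indicator (fun _ => 2 * q) ω +
        (A (-1) (-1)).indicator (fun _ => 2 * q - 2) ω) := by
    have h1 : (1 : ℝ) ≠ -1 := by norm_num
    rcases hX.2.1 n hn ω with h | h <;> rcases hX.2.1 (n + 1) (by omega) ω with h' | h' <;>
      simp [A, indicator, h, h', h1, h1.symm] <;> ring
  have hint (i j c : ℝ) : Integrable ((A i j).indicator fun _ => c) (μ.restrict E) :=
    (integrable_const c).indicator (hA i j)
  have hval (i j c : ℝ) : ∫ ω in E, (A i j).indicator (fun _ => c) ω ∂μ =
      μ.real (E ∩ A i j) * c := by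
    rw [integral_indicator_const c (hA i j), smul_eq_mul, measureReal_restrict_apply (hA i j),
      inter_comm]
  have hker (i j : ℝ) (hi : i ∈ ({1, -1} : Set ℝ)) (hj : j ∈ ({1, -1} : Set ℝ)) :
      μ.real (E ∩ A i j) = crwKernel p q i j * μ.real (E ∩ {ω | X n ω = i}) := by
    have hk : 0 ≤ crwKernel p q i j := by
      unfold crwKernel
      split_ifs <;> linarith
    rw [measureReal_def, hX.2.2.2 n hn i hi j hj E hE, ENNReal.toReal_mul,
      ENNReal.toReal_ofReal hk, measureReal_def]
  have h1 : (-1 : ℝ) ≠ 1 := by norm_num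
  simp_rw [hdecomp]
  rw [integral_add ((hint _ _ _).fun_add (hint _ _ _)) ((hint _ _ _).fun_add (hint _ _ _)),
    integral_add (hint _ _ _) (hint _ _ _), integral_add (hint _ _ _) (hint _ _ _)]
  simp only [hval]
  rw [hker 1 1 (by simp) (by simp), hker 1 (-1) (by simp) (by simp),
    hker (-1) 1 (by simp) (by simp), hker (-1) (-1) (by simp) (by simp)]
  simp only [crwKernel, if_true, if_neg h1, if_neg h1.symm]
  ring

end IsCRW

/-- For a two-state CRW started from the stationary distribution, the process
`M_n = (2-p-q)·S_{n-1} + X_n - (p-q)·(n-1)` (with `S_0 = 0`, so `M_1 = X_1`)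
is a martingale with respect to the natural filtration `F_n = σ(X_1, …, X_n)`. -/
theorem crw_additive_martingale
    (μ : Measure Ω) [IsProbabilityMeasure μ] (X : ℕ → Ω → ℝ) (p q : ℝ)
    (hp0 : 0 < p) (hp1 : p < 1) (hq0 : 0 < q) (hq1 : q < 1)
    (hX : IsCRW μ X p q)
    (S : ℕ → Ω → ℝ) (hS : ∀ n ω, S n ω = ∑ i ∈ Finset.Icc 1 n, X i ω)
    (M : ℕ → Ω → ℝ)
    (hM : ∀ n, 1 ≤ n → ∀ ω,
      M n ω = (2 - p - q) * S (n - 1) ω + X n ω - (p - q) * ((n : ℝ) - 1)) :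
    Martingale (fun k => M (k + 1)) (crwFiltration X hX.1) μ := by
  have hMeq (k : ℕ) : M (k + 1) =
      fun ω => (2 - p - q) * ∑ i ∈ Finset.Icc 1 k, X i ω + X (k + 1) ω - (p - q) * k := by
    funext ω
    rw [hM (k + 1) (by omega), hS]
    simp
  have hint (k : ℕ) : Integrable (M (k + 1)) μ := by
    rw [hMeq]
    exact (((integrable_finsetSum _ fun i hi =>
      hX.integrable (Finset.mem_Icc.mp hi).1).const_mul _).add
        (hX.integrable (by omega))).sub (integrable_const _)
  refine martingale_of_setIntegral_eq_succ (fun k => ?_) hint fun k E hE => ?_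
  · refine Measurable.stronglyMeasurable ?_
    change Measurable[sigmaUpTo X (k + 1)] (M (k + 1))
    rw [hMeq]
    refine Measurable.sub (Measurable.add (Measurable.const_mul ?_ _)
      (measurable_sigmaUpTo (by omega) le_rfl)) measurable_const
    refine Finset.measurable_fun_sum _ fun i hi => ?_
    have hik := Finset.mem_Icc.mp hi
    exact measurable_sigmaUpTo hik.1 (by omega)
  · have hstep (ω : Ω) : M (k + 1 + 1) ω - M (k + 1) ω =
        X (k + 1 + 1) ω - (p - q) - (p + q - 1) * X (k + 1) ω := by
      simp only [hMeq, Finset.sum_Icc_succ_top (Nat.le_add_left 1 k)]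
      push_cast
      ring
    have hzero := hX.setIntegral_centred_step_eq_zero hp0.le hp1.le hq0.le hq1.le
      (Nat.le_add_left 1 k) hE
    simp_rw [← hstep] at hzero
    rw [integral_sub (hint _).integrableOn (hint _).integrableOn] at hzero
    exact (sub_eq_zero.mp hzero).symm
end
end

section
/- Let {X_n}_{n≥1} be a two-state correlated random walk on {1,-1} with parameters 0<p,q<1, p≠q, started from the stationary distribution. Let A,B be positive integers, S_n = X_1+···+X_n, τ = inf{k : S_k = A or S_k = -B}, α = P(S_τ=A), β = P(S_τ=-B). Then the expected ruin time satisfies (p-q)/(2-p-q) = (2-p-q)·(A·α - B·β) + (p+q-1)·(α-β) - (p-q)·(E(τ)-1). -/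
open MeasureTheory ProbabilityTheory Set

noncomputable section

variable {Ω : Type*} [MeasurableSpace Ω]

/-- The index `t ∧ n`, where the value `t = 0` stands for a time that is never reached. -/
def truncTime (t n : ℕ) : ℕ := if t = 0 then n else min t n

lemma truncTime_of_alive {t n : ℕ} (h : t = 0 ∨ n < t) : truncTime t n = n := by
  unfold truncTime; split_ifs <;> omega

lemma truncTime_one (t : ℕ) : truncTime t 1 = 1 := by
  unfold truncTime; split_ifs <;> omega

lemma truncTime_of_le {t n : ℕ} (h0 : t ≠ 0) (h : t ≤ n) : truncTime t n = t := by
  rw [truncTime, if_neg h0, min_eq_left h]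

lemma one_le_truncTime (t : ℕ) {n : ℕ} (hn : 1 ≤ n) : 1 ≤ truncTime t n := by
  unfold truncTime; split_ifs <;> omega

lemma eventually_truncTime_eq {t : ℕ} (h0 : t ≠ 0) :
    ∀ᶠ n in Filter.atTop, truncTime t (n + 1) = t := by
  filter_upwards [Filter.eventually_ge_atTop t] with n hn
  exact truncTime_of_le h0 (by omega)

/-- Stopping a process at `truncTime` adds its `n`-th increment exactly on the survival event. -/
lemma stopped_succ {Ω : Type*} (τ : Ω → ℕ) (f : ℕ → Ω → ℝ) (n : ℕ) (ω : Ω) :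
    f (truncTime (τ ω) (n + 1)) ω = f (truncTime (τ ω) n) ω
      + {ω | τ ω = 0 ∨ n < τ ω}.indicator (fun ω ↦ f (n + 1) ω - f n ω) ω := by
  by_cases h : τ ω = 0 ∨ n < τ ω
  · have h1 : truncTime (τ ω) (n + 1) = n + 1 := by unfold truncTime; split_ifs <;> omega
    rw [indicator_of_mem (by exact h), h1, truncTime_of_alive h]; ring
  · push Not at h
    rw [indicator_of_notMem (by simpa using h), truncTime_of_le h.1 h.2,
      truncTime_of_le h.1 (by omega), add_zero]

/-- If the increments of `f` integrate to zero over the survival events, the stopped process has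
constant expectation. -/
lemma integrable_stopped {μ : Measure Ω} {τ : Ω → ℕ}
    {f : ℕ → Ω → ℝ} (hf : ∀ n, 1 ≤ n → Integrable (f n) μ)
    (hm : ∀ n, MeasurableSet {ω | τ ω = 0 ∨ n < τ ω}) {n : ℕ} (hn : 1 ≤ n) :
    Integrable (fun ω ↦ f (truncTime (τ ω) n) ω) μ := by
  induction n, hn using Nat.le_induction with
  | base => simpa only [truncTime_one] using hf 1 le_rfl
  | succ n hn ih =>
    simp_rw [stopped_succ]
    exact ih.add (((hf _ (by omega)).sub (hf n hn)).indicator (hm n))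

lemma integral_stopped {μ : Measure Ω} {τ : Ω → ℕ}
    {f : ℕ → Ω → ℝ} (hf : ∀ n, 1 ≤ n → Integrable (f n) μ)
    (hm : ∀ n, MeasurableSet {ω | τ ω = 0 ∨ n < τ ω})
    (h0 : ∀ n, 1 ≤ n → ∫ ω in {ω | τ ω = 0 ∨ n < τ ω}, (f (n + 1) ω - f n ω) ∂μ = 0)
    {n : ℕ} (hn : 1 ≤ n) :
    ∫ ω, f (truncTime (τ ω) n) ω ∂μ = ∫ ω, f 1 ω ∂μ := by
  induction n, hn using Nat.le_induction with
  | base => simp only [truncTime_one]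
  | succ n hn ih =>
    have hi : Integrable ({ω | τ ω = 0 ∨ n < τ ω}.indicator fun ω ↦ f (n + 1) ω - f n ω) μ :=
      ((hf _ (by omega)).sub (hf n hn)).indicator (hm n)
    simp_rw [stopped_succ]
    rw [integral_add (integrable_stopped hf hm hn) hi, integral_indicator (hm n), h0 n hn,
      ih, add_zero]

/-- A nearest-neighbour path started at `0` stays in `[-B, A]` up to its first exit. -/
lemma mem_Icc_of_not_exited {s : ℕ → ℝ} {A B : ℕ} (h0 : s 0 = 0)
    (hs : ∀ n, s (n + 1) = s n + 1 ∨ s (n + 1) = s n - 1) {n : ℕ}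
    (hn : ∀ k < n, s k ≠ A ∧ s k ≠ -B) : s n ∈ Icc (-(B : ℝ)) A := by
  have key : ∀ k ≤ n, ∃ z : ℤ, s k = z ∧ -(B : ℤ) ≤ z ∧ z ≤ A := by
    intro k
    induction k with
    | zero => exact fun _ ↦ ⟨0, by simp [h0], by omega, by omega⟩
    | succ k ih =>
      intro hk
      obtain ⟨z, hz, h1, h2⟩ := ih (by omega)
      obtain ⟨h3, h4⟩ := hn k (by omega)
      rw [hz] at h3 h4
      have h3 : z ≠ A := by exact_mod_cast h3
      have h4 : z ≠ -(B : ℤ) := by exact_mod_cast h4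
      rcases hs k with h | h
      · exact ⟨z + 1, by rw [h, hz]; push_cast; ring, by omega, by omega⟩
      · exact ⟨z - 1, by rw [h, hz]; push_cast; ring, by omega, by omega⟩
  obtain ⟨z, hz, h1, h2⟩ := key n le_rfl
  rw [hz]
  exact ⟨by exact_mod_cast h1, by exact_mod_cast h2⟩

/-- The conditional drift of a correlated random walk, integrated over a past event. -/
lemma IsCRW.setIntegral_drift {μ : Measure Ω} [IsProbabilityMeasure μ] {X : ℕ → Ω → ℝ} {p q : ℝ}
    (hp0 : 0 < p) (hp1 : p < 1) (hq0 : 0 < q) (hq1 : q < 1) (hX : IsCRW μ X p q)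
    {n : ℕ} (hn : 1 ≤ n) {E : Set Ω} (hE : MeasurableSet[sigmaUpTo X n] E)
    (hE' : MeasurableSet E) :
    ∫ ω in E, (X (n + 1) ω - (p + q - 1) * X n ω - (p - q)) ∂μ = 0 := by
  obtain ⟨hmeas, hval, -, hM⟩ := hX
  have mk : ∀ i j : ℝ, MeasurableSet (E ∩ {ω | X n ω = i ∧ X (n + 1) ω = j}) := fun i j ↦
    hE'.inter ((hmeas n hn (measurableSet_singleton i)).inter
      (hmeas (n + 1) (by omega) (measurableSet_singleton j)))
  have hreal : ∀ i ∈ ({1, -1} : Set ℝ), ∀ j ∈ ({1, -1} : Set ℝ), 0 ≤ crwKernel p q i j →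
      μ.real (E ∩ {ω | X n ω = i ∧ X (n + 1) ω = j})
        = crwKernel p q i j * μ.real (E ∩ {ω | X n ω = i}) := by
    intro i hi j hj h
    rw [measureReal_def, hM n hn i hi j hj E hE, ENNReal.toReal_mul, ENNReal.toReal_ofReal h]
    rfl
  have hne : (-1 : ℝ) ≠ 1 := by norm_num
  have h11 := hreal 1 (by simp) 1 (by simp) (by simp [crwKernel]; linarith)
  have h1m := hreal 1 (by simp) (-1) (by simp) (by simp [crwKernel, hne]; linarith)
  have hm1 := hreal (-1) (by simp) 1 (by simp) (by simp [crwKernel, hne, hne.symm]; linarith)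
  have hmm := hreal (-1) (by simp) (-1) (by simp) (by simp [crwKernel, hne]; linarith)
  simp only [crwKernel, hne, hne.symm, if_true, if_false] at h11 h1m hm1 hmm
  rw [← integral_indicator hE']
  have hdec : E.indicator (fun ω ↦ X (n + 1) ω - (p + q - 1) * X n ω - (p - q)) = fun ω ↦
      (E ∩ {ω | X n ω = 1 ∧ X (n + 1) ω = 1}).indicator (fun _ ↦ 2 * (1 - p)) ω
      + (E ∩ {ω | X n ω = 1 ∧ X (n + 1) ω = -1}).indicator (fun _ ↦ -2 * p) ω
      + (E ∩ {ω | X n ω = -1 ∧ X (n + 1) ω = 1}).indicator (fun _ ↦ 2 * q) ω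
      + (E ∩ {ω | X n ω = -1 ∧ X (n + 1) ω = -1}).indicator (fun _ ↦ -2 * (1 - q)) ω := by
    funext ω
    by_cases hω : ω ∈ E
    · rcases hval n hn ω with h | h <;> rcases hval (n + 1) (by omega) ω with h' | h' <;>
        simp [indicator, hω, h, h', hne, hne.symm] <;> ring
    · simp [indicator, hω]
  have hint : ∀ (i j c : ℝ), Integrable
      ((E ∩ {ω | X n ω = i ∧ X (n + 1) ω = j}).indicator (fun _ ↦ c)) μ := fun i j c ↦
    (integrable_const c).indicator (mk i j)
  rw [hdec]
  beta_reduce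
  rw [integral_add (by fun_prop) (hint _ _ _), integral_add (by fun_prop) (hint _ _ _),
    integral_add (hint _ _ _) (hint _ _ _)]
  simp only [integral_indicator_const _ (mk _ _), h11, h1m, hm1, hmm, smul_eq_mul]
  ring

lemma IsCRW.integral_one {μ : Measure Ω} [IsProbabilityMeasure μ] {X : ℕ → Ω → ℝ} {p q : ℝ}
    (hp1 : p < 1) (hq1 : q < 1) (hX : IsCRW μ X p q) :
    ∫ ω, X 1 ω ∂μ = (p - q) / (2 - p - q) := by
  obtain ⟨hmeas, hval, h1, -⟩ := hX
  have hm : MeasurableSet {ω | X 1 ω = 1} := hmeas 1 le_rfl (measurableSet_singleton 1)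
  have hdec : X 1 = fun ω ↦ {ω | X 1 ω = 1}.indicator (fun _ ↦ (2 : ℝ)) ω - 1 := by
    funext ω
    rcases hval 1 le_rfl ω with h | h <;> norm_num [indicator, h]
  rw [hdec, integral_sub ((integrable_const _).indicator hm) (integrable_const _),
    integral_indicator_const _ hm, measureReal_def, h1, ENNReal.toReal_ofReal
      (div_nonneg (by linarith) (by linarith))]
  have : 2 - p - q ≠ 0 := by linarith
  simp
  field_simp
  ring

/-- A time whose truncations have bounded expectations is almost surely reached, and has
finite expectation. -/
lemma ae_ne_zero_and_integrable_of_truncTime {μ : Measure Ω} [IsProbabilityMeasure μ] {τ : Ω → ℕ}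
    (hτ : Measurable τ) {C : ℝ}
    (hi : ∀ n, 1 ≤ n → Integrable (fun ω ↦ (truncTime (τ ω) n : ℝ)) μ)
    (hC : ∀ n, 1 ≤ n → ∫ ω, (truncTime (τ ω) n : ℝ) ∂μ ≤ C) :
    (∀ᵐ ω ∂μ, τ ω ≠ 0) ∧ Integrable (fun ω ↦ (τ ω : ℝ)) μ := by
  have h0m : MeasurableSet {ω | τ ω = 0} := hτ (measurableSet_singleton 0)
  have hle : ∀ n : ℕ, 1 ≤ n → n * μ.real {ω | τ ω = 0} ≤ C := by
    intro n hn
    have h1 : ∫ ω, {ω | τ ω = 0}.indicator (fun _ ↦ (n : ℝ)) ω ∂μ ≤ C := by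
      refine le_trans (integral_mono ((integrable_const _).indicator h0m) (hi n hn) ?_) (hC n hn)
      intro ω
      by_cases h : τ ω = 0 <;> simp [indicator, h, truncTime]
    rwa [integral_indicator_const _ h0m, smul_eq_mul, mul_comm] at h1
  have hnull : μ.real {ω | τ ω = 0} = 0 := by
    by_contra hne
    have hpos : 0 < μ.real {ω | τ ω = 0} := lt_of_le_of_ne measureReal_nonneg (Ne.symm hne)
    obtain ⟨n, hn⟩ := exists_nat_gt (C / μ.real {ω | τ ω = 0})
    rw [div_lt_iff₀ hpos] at hn
    have h2 := hle (n + 1) (by omega)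
    push_cast at h2
    linarith
  have hae : ∀ᵐ ω ∂μ, τ ω ≠ 0 := by
    rw [ae_iff]
    simpa using (measureReal_eq_zero_iff (by finiteness)).1 hnull
  refine ⟨hae, (measurable_from_nat.comp hτ).aestronglyMeasurable, ?_⟩
  have hlim : Filter.Tendsto
      (fun n : ℕ ↦ ∫⁻ ω, ENNReal.ofReal (truncTime (τ ω) (n + 1) : ℝ) ∂μ) Filter.atTop
      (nhds (∫⁻ ω, ENNReal.ofReal (τ ω : ℝ) ∂μ)) := by
    refine lintegral_tendsto_of_tendsto_of_monotone
      (fun n ↦ (hi (n + 1) (by omega)).aemeasurable.ennreal_ofReal)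
      (Filter.Eventually.of_forall fun ω m n hmn ↦ ?_) ?_
    · apply ENNReal.ofReal_le_ofReal
      have : truncTime (τ ω) (m + 1) ≤ truncTime (τ ω) (n + 1) := by
        unfold truncTime; split_ifs <;> omega
      exact_mod_cast this
    · filter_upwards [hae] with ω hω
      refine tendsto_const_nhds.congr' ?_
      filter_upwards [eventually_truncTime_eq hω] with n hn
      rw [hn]
  have hbd : ∫⁻ ω, ENNReal.ofReal (τ ω : ℝ) ∂μ ≤ ENNReal.ofReal C := by
    refine le_of_tendsto' hlim fun n ↦ ?_
    rw [← ofReal_integral_eq_lintegral_ofReal (hi (n + 1) (by omega))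
      (Filter.Eventually.of_forall fun ω ↦ Nat.cast_nonneg _)]
    exact ENNReal.ofReal_le_ofReal (hC (n + 1) (by omega))
  rw [hasFiniteIntegral_iff_ofReal (Filter.Eventually.of_forall fun ω ↦ Nat.cast_nonneg _)]
  exact hbd.trans_lt ENNReal.ofReal_lt_top

/-- Measurability with respect to the history of the walk of the event that it has not left
the interval by time `n`. -/
lemma measurableSet_survival {Ω : Type*} {X S : ℕ → Ω → ℝ} (hS : ∀ n ω, S n ω = ∑ i ∈ Finset.Icc 1 n, X i ω)
    (a b : ℝ) (n : ℕ) :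
    MeasurableSet[sigmaUpTo X n] {ω | ∀ k ≤ n, S k ω ≠ a ∧ S k ω ≠ b} := by
  have hX : ∀ i ∈ Finset.Icc 1 n, Measurable[sigmaUpTo X n] (X i) := fun i hi ↦
    (comap_measurable (X i)).mono (le_iSup₂_of_le i hi le_rfl) le_rfl
  have hSm : ∀ k ≤ n, Measurable[sigmaUpTo X n] (S k) := by
    intro k hk
    rw [show S k = fun ω ↦ ∑ i ∈ Finset.Icc 1 k, X i ω from funext (hS k)]
    exact Finset.measurable_fun_sum _ fun i hi ↦
      hX i (Finset.Icc_subset_Icc_right hk hi)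
  simp only [ofPred_forall, ofPred_and]
  refine MeasurableSet.iInter fun k ↦ MeasurableSet.iInter fun hk ↦ ?_
  exact ((hSm k hk) (measurableSet_singleton a)).compl.inter
    ((hSm k hk) (measurableSet_singleton b)).compl

/-- A path has not exited by time `n` iff its exit time is `0` (that is, never) or exceeds `n`. -/
lemma exit_alive_iff {s : ℕ → ℝ} {A B : ℕ} (hA : 0 < A) (hB : 0 < B) (h0 : s 0 = 0) (n : ℕ) :
    (sInf {k | s k = (A : ℝ) ∨ s k = -(B : ℝ)} = 0 ∨
        n < sInf {k | s k = (A : ℝ) ∨ s k = -(B : ℝ)}) ↔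
      ∀ k ≤ n, s k ≠ (A : ℝ) ∧ s k ≠ -(B : ℝ) := by
  have hA' : (0 : ℝ) < A := by exact_mod_cast hA
  have hB' : (0 : ℝ) < B := by exact_mod_cast hB
  have h0' : 0 ∉ {k | s k = (A : ℝ) ∨ s k = -(B : ℝ)} := by
    rintro (h | h) <;> linarith
  constructor
  · rintro (h | h) k hk
    · rcases Nat.sInf_eq_zero.1 h with h | h
      · exact absurd h h0'
      · have : k ∉ {k | s k = (A : ℝ) ∨ s k = -(B : ℝ)} := by simp [h]
        exact not_or.1 this
    · exact not_or.1 (Nat.notMem_of_lt_sInf (hk.trans_lt h))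
  · intro h
    by_contra! hcon
    have hmem := Nat.sInf_mem (Nat.nonempty_of_pos_sInf (Nat.pos_of_ne_zero hcon.1))
    exact not_or.2 (h _ hcon.2) hmem

/-- The Optional Stopping Theorem identity determining `E(τ)` for the asymmetric
two-state CRW started from the stationary distribution:
`(p-q)/(2-p-q) = (2-p-q)·(A·α - B·β) + (p+q-1)·(α-β) - (p-q)·(E(τ)-1)`,
where `α = P(S_τ = A)` and `β = P(S_τ = -B)`. -/
theorem crw_asymmetric_expected_ruin_time_equation
    (μ : Measure Ω) [IsProbabilityMeasure μ] (X : ℕ → Ω → ℝ) (p q : ℝ)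
    (hp0 : 0 < p) (hp1 : p < 1) (hq0 : 0 < q) (hq1 : q < 1) (hpq : p ≠ q)
    (hX : IsCRW μ X p q)
    (A B : ℕ) (hA : 0 < A) (hB : 0 < B)
    (S : ℕ → Ω → ℝ) (hS : ∀ n ω, S n ω = ∑ i ∈ Finset.Icc 1 n, X i ω)
    (τ : Ω → ℕ)
    (hτ : ∀ ω, τ ω = sInf {k | S k ω = (A : ℝ) ∨ S k ω = -(B : ℝ)})
    (α β : ℝ)
    (hα : α = (μ {ω | S (τ ω) ω = (A : ℝ)}).toReal)
    (hβ : β = (μ {ω | S (τ ω) ω = -(B : ℝ)}).toReal) :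
    (p - q) / (2 - p - q)
      = (2 - p - q) * ((A : ℝ) * α - (B : ℝ) * β) + (p + q - 1) * (α - β)
        - (p - q) * ((∫ ω, (τ ω : ℝ) ∂μ) - 1) := by
  obtain ⟨hmeas, hval, -, -⟩ := id hX
  have hAR : (0 : ℝ) < A := by exact_mod_cast hA
  have hBR : (0 : ℝ) < B := by exact_mod_cast hB
  have hS0 : ∀ ω, S 0 ω = 0 := fun ω ↦ by simp [hS]
  have hSs : ∀ n ω, S (n + 1) ω = S n ω + X (n + 1) ω := fun n ω ↦ by
    rw [hS, hS, Finset.sum_Icc_succ_top (by omega)]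
  have hSm : ∀ n, Measurable (S n) := fun n ↦ by
    rw [show S n = fun ω ↦ ∑ i ∈ Finset.Icc 1 n, X i ω from funext (hS n)]
    exact Finset.measurable_fun_sum _ fun i hi ↦ hmeas i (Finset.mem_Icc.1 hi).1
  have hXi : ∀ n, 1 ≤ n → Integrable (X n) μ := fun n hn ↦
    Integrable.of_bound (hmeas n hn).aestronglyMeasurable 1
      (.of_forall fun ω ↦ by rcases hval n hn ω with h | h <;> simp [h])
  have hSi : ∀ n, Integrable (S n) μ := fun n ↦ by
    rw [show S n = fun ω ↦ ∑ i ∈ Finset.Icc 1 n, X i ω from funext (hS n)]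
    exact integrable_finsetSum _ fun i hi ↦ hXi i (Finset.mem_Icc.1 hi).1
  have hiff : ∀ n ω, (τ ω = 0 ∨ n < τ ω) ↔ ∀ k ≤ n, S k ω ≠ A ∧ S k ω ≠ -B := fun n ω ↦ by
    rw [hτ ω]
    exact exit_alive_iff hA hB (hS0 ω) n
  have hset : ∀ n, {ω | τ ω = 0 ∨ n < τ ω} = {ω | ∀ k ≤ n, S k ω ≠ A ∧ S k ω ≠ -B} :=
    fun n ↦ Set.ext fun ω ↦ hiff n ω
  have hm : ∀ n, MeasurableSet[sigmaUpTo X n] {ω | τ ω = 0 ∨ n < τ ω} := fun n ↦ by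
    rw [hset]
    exact measurableSet_survival hS _ _ n
  have hm' : ∀ n, MeasurableSet {ω | τ ω = 0 ∨ n < τ ω} := fun n ↦
    iSup₂_le (fun i hi ↦ (hmeas i (Finset.mem_Icc.1 hi).1).comap_le) _ (hm n)
  have hτm : Measurable τ := by
    have h0 : MeasurableSet {ω | τ ω = 0} := by
      have : {ω | τ ω = 0} = ⋂ n, {ω | τ ω = 0 ∨ n < τ ω} := by
        ext ω
        simp only [mem_ofPred_eq, mem_iInter]
        refine ⟨fun h n ↦ Or.inl h, fun h ↦ ?_⟩
        have := h (τ ω)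
        omega
      rw [this]
      exact MeasurableSet.iInter hm'
    refine measurable_to_countable' fun n ↦ ?_
    rcases n with _ | n
    · exact h0
    · have : τ ⁻¹' {n + 1}
          = ({ω | τ ω = 0 ∨ n < τ ω} \ {ω | τ ω = 0 ∨ n + 1 < τ ω}) := by
        ext ω
        simp only [mem_preimage, mem_singleton_iff, mem_sdiff, mem_ofPred_eq]
        omega
      rw [this]
      exact (hm' n).diff (hm' (n + 1))
  set M : ℕ → Ω → ℝ := fun n ω ↦
    (2 - p - q) * S n ω + (p + q - 1) * X n ω - (p - q) * ((n : ℝ) - 1) with hM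
  have hMi : ∀ n, 1 ≤ n → Integrable (M n) μ := fun n hn ↦
    (((hSi n).const_mul _).add ((hXi n hn).const_mul _)).sub (integrable_const _)
  have hdrift : ∀ n, 1 ≤ n →
      ∫ ω in {ω | τ ω = 0 ∨ n < τ ω}, (M (n + 1) ω - M n ω) ∂μ = 0 := by
    intro n hn
    rw [← hX.setIntegral_drift hp0 hp1 hq0 hq1 hn (hm n) (hm' n)]
    congr 1 with ω
    simp only [hM, hSs]
    push_cast
    ring
  have hM1 : ∫ ω, M 1 ω ∂μ = (p - q) / (2 - p - q) := by
    rw [← hX.integral_one hp1 hq1]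
    congr 1 with ω
    have : S 1 ω = X 1 ω := by rw [hSs, hS0, zero_add]
    simp only [hM, this]
    push_cast
    ring
  have hMint : ∀ n, 1 ≤ n → ∫ ω, M (truncTime (τ ω) n) ω ∂μ = (p - q) / (2 - p - q) :=
    fun n hn ↦ (integral_stopped hMi hm' hdrift hn).trans hM1
  have hMsi : ∀ n, 1 ≤ n → Integrable (fun ω ↦ M (truncTime (τ ω) n) ω) μ :=
    fun n hn ↦ integrable_stopped hMi hm' hn
  have hSIcc : ∀ n ω, S (truncTime (τ ω) n) ω ∈ Icc (-(B : ℝ)) A := by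
    intro n ω
    refine mem_Icc_of_not_exited (s := fun k ↦ S k ω) (hS0 ω) (fun k ↦ ?_) fun k hk ↦ ?_
    · rcases hval (k + 1) (by omega) ω with h | h
      · left; rw [hSs, h]
      · right; rw [hSs, h]; ring
    · refine (hiff k ω).1 ?_ k le_rfl
      unfold truncTime at hk
      split_ifs at hk <;> omega
  have hSb : ∀ n ω, |S (truncTime (τ ω) n) ω| ≤ A + B := fun n ω ↦ by
    obtain ⟨h1, h2⟩ := hSIcc n ω
    rw [abs_le]
    constructor <;> linarith
  have hXb : ∀ n ω, 1 ≤ n → |X n ω| = 1 := fun n ω hn ↦ by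
    rcases hval n hn ω with h | h <;> simp [h]
  set K : ℝ := |2 - p - q| * (A + B) + |p + q - 1| with hK
  have hKb : ∀ n ω, 1 ≤ n → |M (truncTime (τ ω) n) ω
      + (p - q) * ((truncTime (τ ω) n : ℝ) - 1)| ≤ K := by
    intro n ω hn
    simp only [hM, sub_add_cancel]
    refine (abs_add_le _ _).trans ?_
    rw [abs_mul, abs_mul, hXb _ _ (one_le_truncTime _ hn), mul_one, hK]
    gcongr
    exact hSb n ω
  have hti : ∀ n, 1 ≤ n → Integrable (fun ω ↦ (truncTime (τ ω) n : ℝ)) μ := fun n hn ↦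
    integrable_stopped (f := fun n _ ↦ (n : ℝ)) (fun _ _ ↦ integrable_const _) hm' hn
  have hpq' : 0 < |p - q| := abs_pos.2 (sub_ne_zero.2 hpq)
  have htb : ∀ n, 1 ≤ n → ∫ ω, (truncTime (τ ω) n : ℝ) ∂μ
      ≤ (K + |(p - q) / (2 - p - q)|) / |p - q| + 1 := by
    intro n hn
    have h1 : |∫ ω, (M (truncTime (τ ω) n) ω
        + (p - q) * ((truncTime (τ ω) n : ℝ) - 1)) ∂μ| ≤ K := by
      have h := norm_integral_le_of_norm_le_const (μ := μ) (C := K)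
        (f := fun ω ↦ M (truncTime (τ ω) n) ω + (p - q) * ((truncTime (τ ω) n : ℝ) - 1))
        (.of_forall fun ω ↦ hKb n ω hn)
      simpa using h
    have hi : Integrable (fun ω ↦ (p - q) * ((truncTime (τ ω) n : ℝ) - 1)) μ :=
      ((hti n hn).sub (integrable_const _)).const_mul _
    rw [integral_add (hMsi n hn) hi,
      hMint n hn, integral_const_mul, integral_sub (hti n hn) (integrable_const _)] at h1
    simp only [integral_const, probReal_univ, smul_eq_mul, mul_one] at h1
    rw [← sub_le_iff_le_add, le_div_iff₀ hpq']
    set T := ∫ ω, (truncTime (τ ω) n : ℝ) ∂μ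
    calc (T - 1) * |p - q| ≤ |(p - q) * (T - 1)| := by
          rw [abs_mul, mul_comm]
          gcongr
          exact le_abs_self _
      _ = |((p - q) / (2 - p - q) + (p - q) * (T - 1)) - (p - q) / (2 - p - q)| := by
          rw [add_sub_cancel_left]
      _ ≤ _ := (abs_sub _ _).trans (by gcongr)
  obtain ⟨hae, hτi⟩ := ae_ne_zero_and_integrable_of_truncTime hτm hti htb
  have hlim : ∫ ω, M (τ ω) ω ∂μ = (p - q) / (2 - p - q) := by
    have h1 : Filter.Tendsto (fun n : ℕ ↦ ∫ ω, M (truncTime (τ ω) (n + 1)) ω ∂μ) Filter.atTop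
        (nhds (∫ ω, M (τ ω) ω ∂μ)) := by
      refine tendsto_integral_of_dominated_convergence
        (fun ω ↦ K + |p - q| * (τ ω + 1)) (fun n ↦ (hMsi (n + 1) (by omega)).aestronglyMeasurable)
        ((integrable_const _).add ((hτi.add (integrable_const _)).const_mul _)) (fun n ↦ ?_) ?_
      · filter_upwards [hae] with ω hω
        have h2 := hKb (n + 1) ω (by omega)
        have h3 : (truncTime (τ ω) (n + 1) : ℝ) ≤ τ ω := by
          have : truncTime (τ ω) (n + 1) ≤ τ ω := by
            rw [truncTime, if_neg hω]
            exact min_le_left _ _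
          exact_mod_cast this
        have h4 : |(truncTime (τ ω) (n + 1) : ℝ) - 1| ≤ τ ω + 1 := by
          have : (0 : ℝ) ≤ truncTime (τ ω) (n + 1) := Nat.cast_nonneg _
          rw [abs_le]
          constructor <;> linarith
        rw [Real.norm_eq_abs]
        calc |M (truncTime (τ ω) (n + 1)) ω|
            = |(M (truncTime (τ ω) (n + 1)) ω
                + (p - q) * ((truncTime (τ ω) (n + 1) : ℝ) - 1))
                - (p - q) * ((truncTime (τ ω) (n + 1) : ℝ) - 1)| := by rw [add_sub_cancel_right]
          _ ≤ _ := abs_sub _ _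
          _ ≤ _ := by
            rw [abs_mul]
            gcongr
      · filter_upwards [hae] with ω hω
        refine tendsto_const_nhds.congr' ?_
        filter_upwards [eventually_truncTime_eq hω] with n hn
        rw [hn]
    refine tendsto_nhds_unique h1 ?_
    simp only [hMint _ (Nat.le_add_left 1 _)]
    exact tendsto_const_nhds
  have hHm : ∀ a : ℝ, MeasurableSet {ω | S (τ ω) ω = a} := by
    intro a
    have : {ω | S (τ ω) ω = a} = ⋃ k, ({ω | τ ω = k} ∩ {ω | S k ω = a}) := by
      ext ω
      simp
    rw [this]
    exact MeasurableSet.iUnion fun k ↦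
      (hτm (measurableSet_singleton k)).inter (hSm k (measurableSet_singleton a))
  have heval : (fun ω ↦ M (τ ω) ω) =ᵐ[μ] fun ω ↦
      {ω | S (τ ω) ω = (A : ℝ)}.indicator (fun _ ↦ (2 - p - q) * A + (p + q - 1)) ω
      - {ω | S (τ ω) ω = -(B : ℝ)}.indicator (fun _ ↦ (2 - p - q) * B + (p + q - 1)) ω
      - (p - q) * ((τ ω : ℝ) - 1) := by
    filter_upwards [hae] with ω hω
    obtain ⟨k, hk⟩ := Nat.exists_eq_succ_of_ne_zero hω
    have hmem : S (τ ω) ω = (A : ℝ) ∨ S (τ ω) ω = -(B : ℝ) := by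
      have h := hτ ω
      rw [h] at hω
      rw [h]
      exact Nat.sInf_mem (Nat.nonempty_of_pos_sInf (Nat.pos_of_ne_zero hω))
    have hbefore := hSIcc k ω
    rw [truncTime_of_alive (Or.inr (by omega)), mem_Icc] at hbefore
    have hS' : S (τ ω) ω = S k ω + X (τ ω) ω := by rw [hk]; exact hSs k ω
    have hne : (A : ℝ) ≠ -(B : ℝ) := by linarith
    rcases hmem with h | h <;> rcases hval (τ ω) (by omega) ω with h' | h'
    · simp only [hM, indicator, mem_ofPred_eq, h, h', hne, if_true, if_false]
      ring
    · linarith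
    · linarith
    · simp only [hM, indicator, mem_ofPred_eq, h, h', hne.symm, if_true, if_false]
      ring
  rw [← hlim, integral_congr_ae heval]
  have hIi : ∀ a c : ℝ, Integrable ({ω | S (τ ω) ω = a}.indicator (fun _ ↦ c)) μ := fun a c ↦
    (integrable_const c).indicator (hHm a)
  have hdi : Integrable (fun ω ↦ (p - q) * ((τ ω : ℝ) - 1)) μ :=
    (hτi.sub (integrable_const _)).const_mul _
  rw [integral_sub (by fun_prop) hdi,
    integral_sub (hIi _ _) (hIi _ _), integral_const_mul, integral_sub hτi (integrable_const _),
    integral_indicator_const _ (hHm _), integral_indicator_const _ (hHm _), hα, hβ]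
  simp only [integral_const, smul_eq_mul, mul_one, measureReal_def, measure_univ,
    ENNReal.toReal_one]
  ring
end
end

section
/- Let {X_n}_{n≥1} be a symmetric correlated random walk with delays on {1,0,-1} with parameters 0≤p,q,r<1, p+r≤1, started from the stationary distribution, and let S_n = X_1+···+X_n. Then with a = 2(2p+r-1)/(2-2p-r), b = (q-r)(2p+r)/((1+r-q)(2-2p-r)), and c = (1-q)(2p+r)/((1+r-q)(2-2p-r)), the process M_n = S_n² + a·S_n·X_n + b·X_n² - c·n is a martingale with respect to the filtration F_n = σ(X_1,...,X_n). -/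
open MeasureTheory ProbabilityTheory Set

noncomputable section

variable {Ω : Type*} [MeasurableSpace Ω]

/-- The transition kernel of the symmetric correlated random walk with delays on
`{1, 0, -1}`: from state `1` the probabilities of `(1, 0, -1)` are `(p, r, 1-p-r)`;
from state `0` they are `((1-q)/2, q, (1-q)/2)`; from state `-1` they are
`(1-p-r, r, p)`. -/
def delayKernel (p q r : ℝ) (i j : ℝ) : ℝ :=
  if i = 1 then (if j = 1 then p else if j = 0 then r else 1 - p - r)
  else if i = 0 then (if j = 0 then q else (1 - q) / 2)
  else (if j = 1 then 1 - p - r else if j = 0 then r else p)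

/-- `X` is a symmetric correlated random walk with delays on `{1, 0, -1}` with
parameters `p, q, r`, started from the stationary distribution
`((1-q)/(2(1+r-q)), r/(1+r-q), (1-q)/(2(1+r-q)))`: each `X n` (for `n ≥ 1`) is
measurable with values in `{1, 0, -1}`, the initial distribution is stationary,
and the Markov property with the prescribed time-homogeneous transition
probabilities holds, conditionally on `F n = σ(X_1, …, X_n)`. -/
def IsDelayedCRW (μ : Measure Ω) (X : ℕ → Ω → ℝ) (p q r : ℝ) : Prop :=
  (∀ i, 1 ≤ i → Measurable (X i)) ∧
  (∀ n, 1 ≤ n → ∀ ω, X n ω = 1 ∨ X n ω = 0 ∨ X n ω = -1) ∧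
  (μ {ω | X 1 ω = 1} = ENNReal.ofReal ((1 - q) / (2 * (1 + r - q)))) ∧
  (μ {ω | X 1 ω = 0} = ENNReal.ofReal (r / (1 + r - q))) ∧
  (∀ n, 1 ≤ n → ∀ i ∈ ({1, 0, -1} : Set ℝ), ∀ j ∈ ({1, 0, -1} : Set ℝ),
    ∀ E : Set Ω, MeasurableSet[sigmaUpTo X n] E →
      μ (E ∩ {ω | X n ω = i ∧ X (n + 1) ω = j})
        = ENNReal.ofReal (delayKernel p q r i j) * μ (E ∩ {ω | X n ω = i}))

namespace IsDelayedCRW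

lemma delayKernel_nonneg {p q r : ℝ} (hp : 0 ≤ p) (hq0 : 0 ≤ q) (hq1 : q ≤ 1) (hr : 0 ≤ r)
    (hpr : p + r ≤ 1) (i j : ℝ) : 0 ≤ delayKernel p q r i j := by
  unfold delayKernel
  split_ifs <;> linarith

lemma measurable_delayKernel (p q r j : ℝ) : Measurable fun i => delayKernel p q r i j := by
  unfold delayKernel
  exact Measurable.ite (measurableSet_singleton 1) measurable_const
    (Measurable.ite (measurableSet_singleton 0) measurable_const measurable_const)

lemma measurable_step {α : Type*} (X : ℕ → α → ℝ) {i n : ℕ} (hi : 1 ≤ i) (hin : i ≤ n) :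
    Measurable[sigmaUpTo X n] (X i) :=
  Measurable.of_comap_le <|
    le_iSup₂_of_le (f := fun i (_ : i ∈ Finset.Icc 1 n) =>
      MeasurableSpace.comap (X i) inferInstance) i (Finset.mem_Icc.2 ⟨hi, hin⟩) le_rfl

lemma measurable_sum_Icc {α : Type*} (X : ℕ → α → ℝ) (n : ℕ) :
    Measurable[sigmaUpTo X n] fun ω => ∑ i ∈ Finset.Icc 1 n, X i ω :=
  Finset.measurable_sum _ fun _ hi =>
    measurable_step X (Finset.mem_Icc.1 hi).1 (Finset.mem_Icc.1 hi).2

variable {μ : Measure Ω} {X : ℕ → Ω → ℝ} {p q r : ℝ}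

lemma sigmaUpTo_le (hX : IsDelayedCRW μ X p q r) (n : ℕ) :
    sigmaUpTo X n ≤ (inferInstance : MeasurableSpace Ω) :=
  iSup₂_le fun i hi => (hX.1 i (Finset.mem_Icc.mp hi).1).comap_le

lemma mem_states (hX : IsDelayedCRW μ X p q r) {n : ℕ} (hn : 1 ≤ n) (ω : Ω) :
    X n ω ∈ ({1, 0, -1} : Finset ℝ) := by
  simpa using hX.2.1 n hn ω

lemma abs_step_le_one (hX : IsDelayedCRW μ X p q r) {n : ℕ} (hn : 1 ≤ n) (ω : Ω) :
    |X n ω| ≤ 1 := by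
  rcases hX.2.1 n hn ω with h | h | h <;> simp [h]

lemma measureReal_transition (hX : IsDelayedCRW μ X p q r) {n : ℕ} (hn : 1 ≤ n)
    (hP : ∀ i j, 0 ≤ delayKernel p q r i j) {i j : ℝ} (hi : i ∈ ({1, 0, -1} : Finset ℝ))
    (hj : j ∈ ({1, 0, -1} : Finset ℝ)) {E : Set Ω} (hE : MeasurableSet[sigmaUpTo X n] E) :
    μ.real ({ω | X n ω = i ∧ X (n + 1) ω = j} ∩ E)
      = delayKernel p q r i j * μ.real ({ω | X n ω = i} ∩ E) := by
  rw [inter_comm, inter_comm _ E, Measure.real, Measure.real,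
    hX.2.2.2.2 n hn i (by simpa using hi) j (by simpa using hj) E hE, ENNReal.toReal_mul,
    ENNReal.toReal_ofReal (hP i j)]

lemma abs_sum_Icc_le (hX : IsDelayedCRW μ X p q r) (n : ℕ) (ω : Ω) :
    |∑ i ∈ Finset.Icc 1 n, X i ω| ≤ n := by
  refine (Finset.abs_sum_le_sum_abs _ _).trans ?_
  refine (Finset.sum_le_card_nsmul _ _ 1 fun _ hi =>
    hX.abs_step_le_one (Finset.mem_Icc.1 hi).1 ω).trans ?_
  simp

variable [IsProbabilityMeasure μ]

/-- The one-step Markov property for conditional expectations. -/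
lemma condExp_comp_succ (hX : IsDelayedCRW μ X p q r) {n : ℕ} (hn : 1 ≤ n)
    (hP : ∀ i j, 0 ≤ delayKernel p q r i j) (g : ℝ → ℝ) :
    (fun ω => ∑ j ∈ ({1, 0, -1} : Finset ℝ), delayKernel p q r (X n ω) j * g j)
      =ᵐ[μ] μ[fun ω => g (X (n + 1) ω) | sigmaUpTo X n] := by
  set T : Finset ℝ := {1, 0, -1}
  have hXn := hX.1 n hn
  have hXs := hX.1 (n + 1) (by omega)
  have hA (i : ℝ) : MeasurableSet {ω | X n ω = i} := hXn (measurableSet_singleton i)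
  have hB (i j : ℝ) : MeasurableSet {ω | X n ω = i ∧ X (n + 1) ω = j} :=
    (hA i).inter (hXs (measurableSet_singleton j))
  have hf : (fun ω => g (X (n + 1) ω)) = fun ω => ∑ i ∈ T, ∑ j ∈ T,
      {ω | X n ω = i ∧ X (n + 1) ω = j}.indicator (fun _ => g j) ω := by
    ext ω
    have h1 : X n ω ∈ T := hX.mem_states hn ω
    have h2 : X (n + 1) ω ∈ T := hX.mem_states (by omega) ω
    simp only [indicator_apply, mem_ofPred_eq, ite_and]
    rw [Finset.sum_eq_single_of_mem _ h1, Finset.sum_eq_single_of_mem _ h2]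
    · simp
    · intro j _ hj
      simp [hj.symm]
    · intro i _ hi
      simp [hi.symm]
  have hg : (fun ω => ∑ j ∈ T, delayKernel p q r (X n ω) j * g j) = fun ω => ∑ i ∈ T,
      {ω | X n ω = i}.indicator (fun _ => ∑ j ∈ T, delayKernel p q r i j * g j) ω := by
    ext ω
    have h1 : X n ω ∈ T := hX.mem_states hn ω
    simp only [indicator_apply, mem_ofPred_eq, Finset.sum_ite_eq, if_pos h1]
  have hfi (i j : ℝ) : Integrable
      ({ω | X n ω = i ∧ X (n + 1) ω = j}.indicator fun _ => g j) μ :=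
    (integrable_const _).indicator (hB i j)
  have hgi (i : ℝ) : Integrable
      ({ω | X n ω = i}.indicator fun _ => ∑ j ∈ T, delayKernel p q r i j * g j) μ :=
    (integrable_const _).indicator (hA i)
  refine ae_eq_condExp_of_forall_setIntegral_eq (hX.sigmaUpTo_le n) ?_ (fun E _ _ => ?_)
    (fun E hE _ => ?_) ?_
  · rw [hf]
    exact integrable_finsetSum _ fun i _ => integrable_finsetSum _ fun j _ => hfi i j
  · rw [hg]
    exact (integrable_finsetSum _ fun i _ => hgi i).integrableOn
  · rw [hf, hg, integral_finsetSum _ fun i _ => (hgi i).integrableOn,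
      integral_finsetSum _ fun i _ =>
        (integrable_finsetSum _ fun j _ => hfi i j).integrableOn]
    refine Finset.sum_congr rfl fun i hi => ?_
    rw [integral_finsetSum _ fun j _ => (hfi i j).integrableOn, integral_indicator_const _ (hA i),
      smul_eq_mul, Finset.mul_sum]
    refine Finset.sum_congr rfl fun j hj => ?_
    rw [integral_indicator_const _ (hB i j), smul_eq_mul, measureReal_restrict_apply (hA i),
      measureReal_restrict_apply (hB i j), hX.measureReal_transition hn hP hi hj hE]
    ring
  · refine (Measurable.stronglyMeasurable ?_).aestronglyMeasurable
    exact Finset.measurable_sum _ fun j _ =>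
      ((measurable_delayKernel p q r j).comp (measurable_step X hn le_rfl)).mul_const _

lemma condExp_succ (hX : IsDelayedCRW μ X p q r) {n : ℕ} (hn : 1 ≤ n)
    (hP : ∀ i j, 0 ≤ delayKernel p q r i j) :
    μ[X (n + 1) | sigmaUpTo X n] =ᵐ[μ] fun ω => (2 * p + r - 1) * X n ω := by
  filter_upwards [hX.condExp_comp_succ hn hP id] with ω h
  refine h.symm.trans ?_
  rw [Finset.sum_insert (by norm_num), Finset.sum_insert (by norm_num), Finset.sum_singleton]
  rcases hX.2.1 n hn ω with h | h | h <;> rw [h] <;> norm_num [delayKernel] <;> ring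

lemma condExp_succ_sq (hX : IsDelayedCRW μ X p q r) {n : ℕ} (hn : 1 ≤ n)
    (hP : ∀ i j, 0 ≤ delayKernel p q r i j) :
    μ[fun ω => X (n + 1) ω ^ 2 | sigmaUpTo X n]
      =ᵐ[μ] fun ω => (1 - q) + (q - r) * X n ω ^ 2 := by
  filter_upwards [hX.condExp_comp_succ hn hP (· ^ 2)] with ω h
  refine h.symm.trans ?_
  rw [Finset.sum_insert (by norm_num), Finset.sum_insert (by norm_num), Finset.sum_singleton]
  rcases hX.2.1 n hn ω with h | h | h <;> rw [h] <;> norm_num [delayKernel] <;> ring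

/-- The compensation identities satisfied by the coefficients of the quadratic martingale. -/
lemma coefficients_balance {p q r a b c : ℝ} (hd : 2 - 2 * p - r ≠ 0) (he : 1 + r - q ≠ 0)
    (ha : a = 2 * (2 * p + r - 1) / (2 - 2 * p - r))
    (hb : b = (q - r) * (2 * p + r) / ((1 + r - q) * (2 - 2 * p - r)))
    (hc : c = (1 - q) * (2 * p + r) / ((1 + r - q) * (2 - 2 * p - r))) :
    (2 + a) * (2 * p + r - 1) = a ∧ (1 + a + b) * (q - r) = b ∧ (1 + a + b) * (1 - q) = c := by
  obtain ⟨d, hd'⟩ : ∃ d, d = 2 - 2 * p - r := ⟨_, rfl⟩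
  obtain ⟨e, he'⟩ : ∃ e, e = 1 + r - q := ⟨_, rfl⟩
  rw [← hd'] at hd ha hb hc
  rw [← he'] at he hb hc
  subst ha hb hc
  refine ⟨?_, ?_, ?_⟩ <;> field_simp <;> rw [hd'] <;> (try rw [he']) <;> ring

end IsDelayedCRW

/-- For a symmetric CRW with delays started from the stationary distribution, with
`a = 2(2p+r-1)/(2-2p-r)`, `b = (q-r)(2p+r)/((1+r-q)(2-2p-r))`, and
`c = (1-q)(2p+r)/((1+r-q)(2-2p-r))`, the process
`M_n = S_n² + a·S_n·X_n + b·X_n² - c·n` is a martingale with respect to the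
natural filtration `F_n = σ(X_1, …, X_n)`. -/
theorem delayed_crw_quadratic_martingale
    (μ : Measure Ω) [IsProbabilityMeasure μ] (X : ℕ → Ω → ℝ) (p q r : ℝ)
    (hp0 : 0 ≤ p) (hp1 : p < 1) (hq0 : 0 ≤ q) (hq1 : q < 1)
    (hr0 : 0 ≤ r) (hr1 : r < 1) (hpr : p + r ≤ 1)
    (hX : IsDelayedCRW μ X p q r)
    (S : ℕ → Ω → ℝ) (hS : ∀ n ω, S n ω = ∑ i ∈ Finset.Icc 1 n, X i ω)
    (a b c : ℝ)
    (ha : a = 2 * (2 * p + r - 1) / (2 - 2 * p - r))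
    (hb : b = (q - r) * (2 * p + r) / ((1 + r - q) * (2 - 2 * p - r)))
    (hc : c = (1 - q) * (2 * p + r) / ((1 + r - q) * (2 - 2 * p - r))) :
    Martingale
      (fun k => fun ω =>
        (S (k + 1) ω) ^ 2 + a * S (k + 1) ω * X (k + 1) ω
          + b * (X (k + 1) ω) ^ 2 - c * ((k : ℝ) + 1))
      (crwFiltration X hX.1) μ := by
  have hP := IsDelayedCRW.delayKernel_nonneg hp0 hq0 hq1.le hr0 hpr
  have hSm (n : ℕ) : Measurable[sigmaUpTo X n] (S n) := by
    simpa only [← hS] using IsDelayedCRW.measurable_sum_Icc X n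
  have hSb (n : ℕ) (ω : Ω) : |S n ω| ≤ n := hS n ω ▸ hX.abs_sum_Icc_le n ω
  have hXm (n : ℕ) : Measurable[sigmaUpTo X (n + 1)] (X (n + 1)) :=
    IsDelayedCRW.measurable_step X (by omega) le_rfl
  have hSi (n : ℕ) : MemLp (S n) ⊤ μ :=
    memLp_top_of_bound ((hSm n).mono (hX.sigmaUpTo_le n) le_rfl).aestronglyMeasurable n
      (.of_forall (hSb n))
  have hXi (n : ℕ) : MemLp (X (n + 1)) ⊤ μ :=
    memLp_top_of_bound (hX.1 _ (by omega)).aestronglyMeasurable 1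
      (.of_forall (hX.abs_step_le_one (by omega)))
  have hXint (n : ℕ) : Integrable (X (n + 1)) μ := (hXi n).integrable le_top
  have hX2int (n : ℕ) : Integrable (fun ω => X (n + 1) ω ^ 2) μ :=
    ((hXi n).mono_exponent le_top).integrable_sq
  have hS2int (n : ℕ) : Integrable (fun ω => S n ω ^ 2) μ :=
    ((hSi n).mono_exponent le_top).integrable_sq
  have hSXint (m n : ℕ) : Integrable (fun ω => S m ω * X (n + 1) ω) μ :=
    MemLp.integrable_mul (p := 2) (q := 2) ((hSi m).mono_exponent le_top)
      ((hXi n).mono_exponent le_top)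
  refine martingale_nat (fun k => ?_) (fun k => ?_) (fun k => ?_)
  · refine Measurable.stronglyMeasurable ?_
    change Measurable[sigmaUpTo X (k + 1)] _
    have h1 := hSm (k + 1)
    have h2 := hXm k
    fun_prop
  · simp only [mul_assoc]
    exact (((hS2int _).add ((hSXint _ _).const_mul a)).add ((hX2int k).const_mul b)).sub
      (integrable_const _)
  · change _ =ᵐ[μ] μ[_ | sigmaUpTo X (k + 1)]
    obtain ⟨hab, hbb, hcc⟩ :=
      IsDelayedCRW.coefficients_balance (by linarith) (by linarith) ha hb hc
    have hsucc (ω : Ω) : S (k + 1 + 1) ω = S (k + 1) ω + X (k + 1 + 1) ω := by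
      rw [hS, hS, Finset.sum_Icc_succ_top (by omega)]
    set U : Ω → ℝ := fun ω => S (k + 1) ω ^ 2 - c * ((k : ℝ) + 1 + 1) with hU
    set V : Ω → ℝ := fun ω => S (k + 1) ω * X (k + 1 + 1) ω with hV
    set W : Ω → ℝ := fun ω => X (k + 1 + 1) ω ^ 2 with hW
    have hUint : Integrable U μ := (hS2int _).sub (integrable_const _)
    have hVint : Integrable V μ := hSXint _ _
    have hWint : Integrable W μ := hX2int _
    have hdecomp : (fun ω => S (k + 1 + 1) ω ^ 2 + a * S (k + 1 + 1) ω * X (k + 1 + 1) ω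
        + b * X (k + 1 + 1) ω ^ 2 - c * (((k + 1 : ℕ) : ℝ) + 1))
        = U + (2 + a) • V + (1 + a + b) • W := by
      ext ω
      simp only [hsucc, hU, hV, hW, Pi.add_apply, Pi.smul_apply, smul_eq_mul]
      push_cast
      ring
    rw [hdecomp]
    have hUm : μ[U | sigmaUpTo X (k + 1)] = U :=
      condExp_of_stronglyMeasurable (hX.sigmaUpTo_le _)
        (((hSm (k + 1)).pow_const 2).sub_const _).stronglyMeasurable hUint
    have hpull : μ[V | sigmaUpTo X (k + 1)]
        =ᵐ[μ] S (k + 1) * μ[X (k + 1 + 1) | sigmaUpTo X (k + 1)] :=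
      condExp_mul_of_stronglyMeasurable_left (hSm (k + 1)).stronglyMeasurable
        (hSXint _ _) (hXint _)
    filter_upwards [
      condExp_add (hUint.add (hVint.smul (2 + a)))
        (hWint.smul (1 + a + b)) (sigmaUpTo X (k + 1)),
      condExp_add hUint (hVint.smul (2 + a)) (sigmaUpTo X (k + 1)),
      condExp_smul (μ := μ) (2 + a) V (sigmaUpTo X (k + 1)),
      condExp_smul (μ := μ) (1 + a + b) W (sigmaUpTo X (k + 1)), hpull,
      hX.condExp_succ (n := k + 1) (by omega) hP,
      hX.condExp_succ_sq (n := k + 1) (by omega) hP] with ω h1 h2 h3 h4 h5 h6 h7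
    refine Eq.trans ?_ h1.symm
    rw [Pi.add_apply, h2, Pi.add_apply, h3, h4, hUm]
    simp only [Pi.smul_apply, smul_eq_mul]
    rw [h5, Pi.mul_apply, h6, h7]
    simp only [hU]
    linear_combination (-(S (k + 1) ω * X (k + 1) ω)) * hab - X (k + 1) ω ^ 2 * hbb - hcc
end
end
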